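/- Let V be a finite set of control locations and E a directed edge relation on V. Call a vertex v cyclic if there exists a walk of positive length from v back to v. Let b : V → ℕ be a bound function. Then the set of all walks of the graph (V, E) in which every cyclic vertex v occurs at most b(v) times is finite. (This is the claim that sGuard's bounded symbolic-trace enumeration, which visits each loop head n at most bound(n) times, always terminates and returns a finite set of symbolic traces.) -/

import Mathlib

/-- A walk of a directed graph with edge relation `E` is a finite nonempty sequence of
vertices in which every pair of consecutive vertices is related by `E`. -/
def IsWalk {V : Type*} (E : V → V → Prop) (l : List V) : Prop :=
  l ≠ [] ∧ l.Chain' E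

/-- A vertex `v` is cyclic if there exists a walk of positive length
(i.e. with at least two vertex occurrences) from `v` back to `v`. -/
def CyclicVertex {V : Type*} (E : V → V → Prop) (v : V) : Prop :=
  ∃ l : List V, l.Chain' E ∧ 2 ≤ l.length ∧ l.head? = some v ∧ l.getLast? = some v

/-- A vertex occurring at least twice in a walk is cyclic. -/
theorem cyclicVertex_of_two_le_count {V : Type*} [DecidableEq V] {E : V → V → Prop}
    {l : List V} {v : V} (hl : l.IsChain E) (hv : 2 ≤ l.count v) : CyclicVertex E v := by
  obtain ⟨s, t, rfl, hs⟩ :=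
    List.eq_append_cons_of_mem (List.count_pos_iff.mp (by omega : 0 < l.count v))
  have ht : v ∈ t := by
    rw [List.count_append, List.count_cons_self, List.count_eq_zero_of_not_mem hs] at hv
    exact List.count_pos_iff.mp (by omega)
  obtain ⟨t₁, t₂, rfl⟩ := List.append_of_mem ht
  refine ⟨v :: (t₁ ++ [v]), hl.infix ⟨s, t₂, by simp⟩, by simp, rfl, ?_⟩
  rw [← List.cons_append, List.getLast?_append]
  rfl

/-- The set of all walks of a finite directed graph `(V, E)` in which every cyclic
vertex `v` occurs at most `b v` times is finite. -/
theorem bounded_walks_finite {V : Type*} [Fintype V] [DecidableEq V]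
    (E : V → V → Prop) (b : V → ℕ) :
    {l : List V | IsWalk E l ∧ ∀ v : V, CyclicVertex E v → l.count v ≤ b v}.Finite := by
  refine (List.finite_length_le V (∑ v, (b v + 1))).subset ?_
  rintro l ⟨⟨-, hl⟩, hb⟩
  change l.length ≤ _
  rw [← Multiset.coe_card, ← Multiset.sum_count_eq_card (s := Finset.univ) (by simp)]
  refine Finset.sum_le_sum fun v _ => ?_
  rw [Multiset.coe_count]
  by_cases hv : CyclicVertex E v
  · exact (hb v hv).trans (Nat.le_succ _)
  · have : ¬ 2 ≤ l.count v := fun h => hv (cyclicVertex_of_two_le_count hl h)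
    omega
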